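/- Let v₁, …, v_d ∈ ℤ^d be such that P := conv{0, v₁, …, v_d} is an empty d-simplex (0, v₁, …, v_d are affinely independent and P ∩ ℤ^d = {0, v₁, …, v_d}), let w be the lattice width of P with respect to ℤ^d, and let m ≥ 2 be an integer. Identify ℝ^{md} with m-tuples of vectors of ℝ^d, and for i ∈ {1,…,d} and j ∈ {1,…,m} let v_i^{(j)} ∈ ℝ^{md} be the vector whose j-th block equals v_i and whose other blocks are 0; set w_i^{(j)} := (m−2)·v_i^{(j)} + v_{i+1}^{(j+1)}, where the index i is taken cyclically in {1,…,d} and the index j cyclically in {1,…,m}; and let P_m := conv({0} ∪ {w_i^{(j)} : 1 ≤ i ≤ d, 1 ≤ j ≤ m}) ⊆ ℝ^{md}. Then: (1) the lattice width of P_m with respect to ℤ^{md} is at least (m−3)·w; and (2) P_m ∩ ℤ^{md} = {0} ∪ {w_i^{(j)} : 1 ≤ i ≤ d, 1 ≤ j ≤ m}. -/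

import Mathlib

open Set

/-- The lattice width of a set `K ⊆ ℝ^ι` with respect to the integer lattice `ℤ^ι`. -/
noncomputable def latticeWidth {ι : Type*} (K : Set (ι → ℝ)) : ℝ :=
  sInf { w : ℝ | ∃ f : (ι → ℝ) →ₗ[ℝ] ℝ,
    (∀ v : ι → ℤ, ∃ k : ℤ, f (fun i => (v i : ℝ)) = (k : ℝ)) ∧ f ≠ 0 ∧
    w = sSup (f '' K) - sInf (f '' K) }

/-- `v_i^{(j)} ∈ ℝ^{md}`: the vector whose `j`-th block (of length `d`) is `v i` and
whose other blocks are `0`.  Here `ℝ^{md}` is realized as `Fin m × Fin d → ℝ`. -/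
def blockVec (d m : ℕ) (v : Fin d → (Fin d → ℤ)) (i : Fin d) (j : Fin m) :
    Fin m × Fin d → ℝ :=
  fun p => if p.1 = j then (v i p.2 : ℝ) else 0

/-- `w_i^{(j)} := (m−2)·v_i^{(j)} + v_{i+1}^{(j+1)}`, indices taken cyclically. -/
noncomputable def wVec (d m : ℕ) (v : Fin d → (Fin d → ℤ)) (i : Fin d) (j : Fin m) :
    Fin m × Fin d → ℝ :=
  ((m : ℝ) - 2) • blockVec d m v i j +
    blockVec d m v (finRotate d i) (finRotate m j)

/-- The functional `f` takes integer values on the integer lattice. -/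
def IsIntegerFunctional {ι : Type*} (f : (ι → ℝ) →ₗ[ℝ] ℝ) : Prop :=
  ∀ v : ι → ℤ, ∃ k : ℤ, f (fun i => (v i : ℝ)) = (k : ℝ)

/-- The width of a set `K` with respect to a functional `f`. -/
noncomputable def functionalWidth {E : Type*} [AddCommGroup E] [Module ℝ E]
    (K : Set E) (f : E →ₗ[ℝ] ℝ) : ℝ :=
  sSup (f '' K) - sInf (f '' K)

theorem mem_convexHull_zero_union_range_iff {ι E : Type*} [Fintype ι] [AddCommGroup E]
    [Module ℝ E] (g : ι → E) (x : E) :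
    x ∈ convexHull ℝ ({0} ∪ range g) ↔
      ∃ c : ι → ℝ, (∀ i, 0 ≤ c i) ∧ ∑ i, c i ≤ 1 ∧ ∑ i, c i • g i = x := by
  classical
  constructor
  · intro hx
    refine convexHull_min (t := {x | ∃ c : ι → ℝ, (∀ i, 0 ≤ c i) ∧ ∑ i, c i ≤ 1 ∧
      ∑ i, c i • g i = x}) ?_ ?_ hx
    · rintro y (rfl | ⟨i, rfl⟩)
      · exact ⟨0, by simp⟩
      · refine ⟨Pi.single i 1, fun j => ?_, by simp, ?_⟩
        · by_cases h : j = i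
          · subst h; simp
          · simp [h]
        · rw [Finset.sum_eq_single i] <;> simp +contextual
    · rintro x ⟨c, hc, hc1, rfl⟩ y ⟨e, he, he1, rfl⟩ a b ha hb hab
      refine ⟨fun i => a * c i + b * e i, fun i => ?_, ?_, ?_⟩
      · have := hc i
        have := he i
        positivity
      · rw [Finset.sum_add_distrib, ← Finset.mul_sum, ← Finset.mul_sum]
        nlinarith
      · simp only [add_smul, mul_smul, Finset.sum_add_distrib, Finset.smul_sum]
  · rintro ⟨c, hc, hc1, rfl⟩
    have h := (convex_convexHull ℝ ({0} ∪ range g)).sum_mem (t := Finset.univ)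
      (w := fun o : Option ι => o.elim (1 - ∑ i, c i) c) (z := fun o => o.elim 0 g)
      (by rintro (_ | i) _ <;> simp [hc, hc1]) (by simp [Fintype.sum_option])
      (by
        rintro (_ | i) _
        · exact subset_convexHull ℝ _ (by simp)
        · exact subset_convexHull ℝ _ (by simp))
    simpa [Fintype.sum_option] using h

theorem isCompact_image_convexHull {ι : Type*} [Fintype ι] {S : Set (ι → ℝ)} (hS : S.Finite)
    (f : (ι → ℝ) →ₗ[ℝ] ℝ) : IsCompact (f '' convexHull ℝ S) :=
  (hS.isCompact_convexHull ℝ).image f.continuous_of_finiteDimensional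

theorem sub_le_functionalWidth_convexHull {ι : Type*} [Fintype ι] {S : Set (ι → ℝ)}
    (hS : S.Finite) (f : (ι → ℝ) →ₗ[ℝ] ℝ) {x y : ι → ℝ} (hx : x ∈ S) (hy : y ∈ S) :
    f x - f y ≤ functionalWidth (convexHull ℝ S) f := by
  have hc := isCompact_image_convexHull hS f
  exact sub_le_sub
    (le_csSup hc.bddAbove (mem_image_of_mem f (subset_convexHull ℝ S hx)))
    (csInf_le hc.bddBelow (mem_image_of_mem f (subset_convexHull ℝ S hy)))

theorem functionalWidth_convexHull_nonneg {ι : Type*} [Fintype ι] {S : Set (ι → ℝ)}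
    (hS : S.Finite) (hne : S.Nonempty) (f : (ι → ℝ) →ₗ[ℝ] ℝ) :
    0 ≤ functionalWidth (convexHull ℝ S) f := by
  obtain ⟨x, hx⟩ := hne
  simpa using sub_le_functionalWidth_convexHull hS f hx hx

theorem exists_functionalWidth_convexHull_le {E : Type*} [AddCommGroup E] [Module ℝ E]
    {S : Set E} (hS : S.Finite) (hne : S.Nonempty) (f : E →ₗ[ℝ] ℝ) :
    ∃ x ∈ S, ∃ y ∈ S, functionalWidth (convexHull ℝ S) f ≤ f x - f y := by
  obtain ⟨x, hx, hmax⟩ := exists_max_image S f hS hne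
  obtain ⟨y, hy, hmin⟩ := exists_min_image S f hS hne
  have hne' : (f '' convexHull ℝ S).Nonempty := (hne.convexHull).image f
  refine ⟨x, hx, y, hy, sub_le_sub (csSup_le hne' ?_) (le_csInf hne' ?_)⟩
  · rintro _ ⟨z, hz, rfl⟩
    exact convexHull_min (t := {z | f z ≤ f x}) hmax (convex_halfSpace_le f.isLinear _) hz
  · rintro _ ⟨z, hz, rfl⟩
    exact convexHull_min (t := {z | f y ≤ f z}) hmin (convex_halfSpace_ge f.isLinear _) hz

theorem latticeWidth_convexHull_le {ι : Type*} [Fintype ι] {S : Set (ι → ℝ)}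
    (hS : S.Finite) (hne : S.Nonempty) {f : (ι → ℝ) →ₗ[ℝ] ℝ} (hf : IsIntegerFunctional f)
    (hf0 : f ≠ 0) : latticeWidth (convexHull ℝ S) ≤ functionalWidth (convexHull ℝ S) f := by
  refine csInf_le ⟨0, ?_⟩ ⟨f, hf, hf0, rfl⟩
  rintro _ ⟨g, -, -, rfl⟩
  exact functionalWidth_convexHull_nonneg hS hne g

theorem latticeWidth_convexHull_nonneg {ι : Type*} [Fintype ι] {S : Set (ι → ℝ)}
    (hS : S.Finite) (hne : S.Nonempty) : 0 ≤ latticeWidth (convexHull ℝ S) := by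
  refine Real.sInf_nonneg ?_
  rintro _ ⟨g, -, -, rfl⟩
  exact functionalWidth_convexHull_nonneg hS hne g

theorem le_latticeWidth {ι : Type*} [Nonempty ι] {K : Set (ι → ℝ)} {b : ℝ}
    (h : ∀ f : (ι → ℝ) →ₗ[ℝ] ℝ, IsIntegerFunctional f → f ≠ 0 → b ≤ functionalWidth K f) :
    b ≤ latticeWidth K := by
  classical
  refine le_csInf ?_ ?_
  · obtain ⟨i⟩ := ‹Nonempty ι›
    refine ⟨_, LinearMap.proj i, fun v => ⟨v i, rfl⟩, fun h0 => ?_, rfl⟩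
    simpa using LinearMap.congr_fun h0 (Pi.single i 1)
  · rintro _ ⟨f, hf, hf0, rfl⟩
    exact h f hf hf0

/-- The inclusion of `ℝ^d` as the `j`-th block of `ℝ^{md}`. -/
def blockIncl (d m : ℕ) (j : Fin m) : (Fin d → ℝ) →ₗ[ℝ] (Fin m × Fin d → ℝ) :=
  LinearMap.pi fun p => if p.1 = j then LinearMap.proj p.2 else 0

theorem blockIncl_apply {d m : ℕ} (j : Fin m) (x : Fin d → ℝ) (p : Fin m × Fin d) :
    blockIncl d m j x p = if p.1 = j then x p.2 else 0 := by
  by_cases h : p.1 = j <;> simp [blockIncl, h]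

theorem blockIncl_intCast {d m : ℕ} (v : Fin d → Fin d → ℤ) (i : Fin d) (j : Fin m) :
    blockIncl d m j (fun k => (v i k : ℝ)) = blockVec d m v i j := by
  ext p
  simp [blockIncl_apply, blockVec]

theorem sum_blockIncl {d m : ℕ} (x : Fin m × Fin d → ℝ) :
    ∑ j, blockIncl d m j (fun k => x (j, k)) = x := by
  ext p
  simp [blockIncl_apply]

theorem IsIntegerFunctional.comp_blockIncl {d m : ℕ} {f : (Fin m × Fin d → ℝ) →ₗ[ℝ] ℝ}
    (hf : IsIntegerFunctional f) (j : Fin m) :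
    IsIntegerFunctional (f ∘ₗ blockIncl d m j) := by
  intro v
  obtain ⟨k, hk⟩ := hf fun p => if p.1 = j then v p.2 else 0
  refine ⟨k, hk ▸ ?_⟩
  rw [LinearMap.comp_apply]
  congr 1
  ext p
  simp [blockIncl_apply]

theorem exists_comp_blockIncl_ne_zero {d m : ℕ} {f : (Fin m × Fin d → ℝ) →ₗ[ℝ] ℝ}
    (hf : f ≠ 0) : ∃ j, f ∘ₗ blockIncl d m j ≠ 0 := by
  by_contra! h
  refine hf (LinearMap.ext fun x => ?_)
  rw [← sum_blockIncl x, map_sum]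
  exact Finset.sum_eq_zero fun j _ => LinearMap.congr_fun (h j) _

theorem setOf_eq_wVec {d m : ℕ} (v : Fin d → Fin d → ℤ) :
    {x : Fin m × Fin d → ℝ | ∃ i j, x = wVec d m v i j} =
      range fun p : Fin m × Fin d => wVec d m v p.2 p.1 := by
  ext x
  constructor
  · rintro ⟨i, j, rfl⟩
    exact ⟨(j, i), rfl⟩
  · rintro ⟨p, rfl⟩
    exact ⟨p.2, p.1, rfl⟩

theorem exists_apply_eq_block_add_block {d m : ℕ} (v : Fin d → Fin d → ℤ)
    (f : (Fin m × Fin d → ℝ) →ₗ[ℝ] ℝ) (j : Fin m) {x : Fin d → ℝ}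
    (hx : x ∈ {0} ∪ range fun i => fun k => (v i k : ℝ)) :
    ∃ X ∈ {0} ∪ range fun p : Fin m × Fin d => wVec d m v p.2 p.1,
      ∃ u ∈ {0} ∪ range fun i => fun k => (v i k : ℝ),
        f X = ((m : ℝ) - 2) * (f ∘ₗ blockIncl d m j) x +
          (f ∘ₗ blockIncl d m (finRotate m j)) u := by
  rcases hx with rfl | ⟨i, rfl⟩
  · exact ⟨0, by simp, 0, by simp, by simp⟩
  · refine ⟨wVec d m v i j, Or.inr ⟨(j, i), rfl⟩, _, Or.inr ⟨finRotate d i, rfl⟩, ?_⟩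
    simp [wVec, blockIncl_intCast]

theorem sub_three_mul_latticeWidth_le {d m : ℕ} (hd : 0 < d) (hm : 2 ≤ m)
    (v : Fin d → Fin d → ℤ) :
    ((m : ℝ) - 3) * latticeWidth (convexHull ℝ
        ({0} ∪ range (fun i => fun j => (v i j : ℝ)))) ≤
      latticeWidth (convexHull ℝ
        ({0} ∪ range fun p : Fin m × Fin d => wVec d m v p.2 p.1)) := by
  have : Nonempty (Fin d) := ⟨⟨0, hd⟩⟩
  have : Nonempty (Fin m) := ⟨⟨0, by lia⟩⟩
  set S : Set (Fin d → ℝ) := {0} ∪ range (fun i => fun j => (v i j : ℝ))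
  set T := {0} ∪ range fun p : Fin m × Fin d => wVec d m v p.2 p.1
  have hS : S.Finite := (finite_singleton _).union (finite_range _)
  have hT : T.Finite := (finite_singleton _).union (finite_range _)
  have hSne : S.Nonempty := ⟨0, Or.inl rfl⟩
  have hTne : T.Nonempty := ⟨0, Or.inl rfl⟩
  refine le_latticeWidth fun f hf hf0 => ?_
  rcases hm.eq_or_lt with rfl | hm3
  · have := latticeWidth_convexHull_nonneg hS hSne
    have := functionalWidth_convexHull_nonneg hT hTne f
    push_cast
    linarith
  have hm3 : (3 : ℝ) ≤ m := by exact_mod_cast hm3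
  let W : Fin m → ℝ := fun j => functionalWidth (convexHull ℝ S) (f ∘ₗ blockIncl d m j)
  obtain ⟨j, hj⟩ := Finite.exists_max W
  obtain ⟨j₀, hj₀⟩ := exists_comp_blockIncl_ne_zero hf0
  have hw : latticeWidth (convexHull ℝ S) ≤ W j :=
    (latticeWidth_convexHull_le hS hSne (hf.comp_blockIncl j₀) hj₀).trans (hj j₀)
  obtain ⟨x, hx, y, hy, hxy⟩ :=
    exists_functionalWidth_convexHull_le hS hSne (f ∘ₗ blockIncl d m j)
  obtain ⟨X, hX, a, ha, hXa⟩ := exists_apply_eq_block_add_block v f j hx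
  obtain ⟨Y, hY, b, hb, hYb⟩ := exists_apply_eq_block_add_block v f j hy
  have hXY := sub_le_functionalWidth_convexHull hT f hX hY
  have hba := sub_le_functionalWidth_convexHull hS
    (f ∘ₗ blockIncl d m (finRotate m j)) hb ha
  have hmax : functionalWidth (convexHull ℝ S) (f ∘ₗ blockIncl d m (finRotate m j)) ≤ W j :=
    hj _
  have hxy' : W j ≤ (f ∘ₗ blockIncl d m j) x - (f ∘ₗ blockIncl d m j) y := hxy
  have h₁ := mul_le_mul_of_nonneg_left hxy' (by linarith : (0 : ℝ) ≤ m - 2)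
  have h₂ := mul_le_mul_of_nonneg_left hw (by linarith : (0 : ℝ) ≤ m - 3)
  linarith

theorem linearIndependent_of_affineIndependent_cons_zero {d : ℕ} {E : Type*} [AddCommGroup E]
    [Module ℝ E] {g : Fin d → E}
    (h : AffineIndependent ℝ (Fin.cons (0 : E) g : Fin (d + 1) → E)) :
    LinearIndependent ℝ g := by
  have h₁ := (affineIndependent_iff_linearIndependent_vsub ℝ _ (0 : Fin (d + 1))).1 h
  have h₂ := h₁.comp (fun i : Fin d => ⟨i.succ, Fin.succ_ne_zero i⟩)
    (fun a b hab => by simpa using hab)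
  simpa [Function.comp_def] using h₂

theorem coeff_eq_zero_or_single_of_intCast {d : ℕ} {v : Fin d → Fin d → ℤ}
    (hli : LinearIndependent ℝ fun i => fun j => (v i j : ℝ))
    (hempty : ∀ z : Fin d → ℤ,
      (fun j => (z j : ℝ)) ∈ convexHull ℝ ({0} ∪ range (fun i => fun j => (v i j : ℝ))) →
        z = 0 ∨ ∃ i, z = v i)
    {c : Fin d → ℝ} (hc : ∀ i, 0 ≤ c i) (hc1 : ∑ i, c i ≤ 1) {z : Fin d → ℤ}
    (hz : ∀ k, ∑ i, c i * (v i k : ℝ) = z k) :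
    c = 0 ∨ ∃ i, c = Pi.single i 1 := by
  have hsum : ∑ i, c i • (fun j => (v i j : ℝ)) = fun j => (z j : ℝ) := by
    ext k
    simpa using hz k
  have hinj := hli.fintypeLinearCombination_injective
  rcases hempty z ((mem_convexHull_zero_union_range_iff _ _).2 ⟨c, hc, hc1, hsum⟩) with
    rfl | ⟨i, rfl⟩
  · left
    apply hinj
    simp only [Fintype.linearCombination_apply, hsum]
    ext k
    simp
  · right
    refine ⟨i, hinj ?_⟩
    rw [Fintype.linearCombination_apply_single, one_smul, Fintype.linearCombination_apply, hsum]

theorem sum_smul_wVec_apply {d m : ℕ} (v : Fin d → Fin d → ℤ) (c : Fin m × Fin d → ℝ)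
    (j : Fin m) (k : Fin d) :
    (∑ p, c p • wVec d m v p.2 p.1) (finRotate m j, k) =
      ∑ i, (((m : ℝ) - 2) * c (finRotate m j, i) + c (j, (finRotate d).symm i)) *
        (v i k : ℝ) := by
  have hshift : ∑ i, c (j, (finRotate d).symm i) * (v i k : ℝ) =
      ∑ i, c (j, i) * (v (finRotate d i) k : ℝ) := by
    rw [← Equiv.sum_comp (finRotate d)]
    simp only [Equiv.symm_apply_apply]
  simp only [add_mul, Finset.sum_add_distrib]
  rw [hshift, Finset.sum_apply, Fintype.sum_prod_type_right, ← Finset.sum_add_distrib]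
  refine Finset.sum_congr rfl fun i _ => ?_
  simp only [wVec, blockVec, Pi.smul_apply, Pi.add_apply, smul_eq_mul, mul_add,
    Finset.sum_add_distrib, mul_ite, mul_zero, EmbeddingLike.apply_eq_iff_eq,
    Finset.sum_ite_eq, Finset.mem_univ, if_true]
  ring

open Fin.NatCast Fin.CommRing in
theorem forall_of_finRotate_imp {m : ℕ} {Q : Fin m → Prop} {j₀ : Fin m} (h₀ : Q j₀)
    (h : ∀ j, Q (finRotate m j) → Q j) (j : Fin m) : Q j := by
  obtain _ | n := m
  · exact j.elim0
  have hsub : ∀ k : ℕ, Q (j₀ - (k : Fin (n + 1))) := by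
    intro k
    induction k with
    | zero => simpa using h₀
    | succ k ih =>
      apply h
      rw [finRotate_apply]
      convert ih using 1
      push_cast
      abel
  simpa using hsub (j₀ - j).val

theorem eq_zero_or_exists_eq_one_of_forall_block {d m : ℕ} (hm : 2 ≤ m)
    {c : Fin m × Fin d → ℝ} (hc : ∀ p, 0 ≤ c p) (hc1 : ∑ p, c p ≤ 1)
    (h : ∀ j, ∑ i, (((m : ℝ) - 2) * c (finRotate m j, i) + c (j, (finRotate d).symm i)) ≤ 1 →
      (fun i => ((m : ℝ) - 2) * c (finRotate m j, i) + c (j, (finRotate d).symm i)) = 0 ∨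
      ∃ k, (fun i => ((m : ℝ) - 2) * c (finRotate m j, i) + c (j, (finRotate d).symm i)) =
        Pi.single k 1) :
    c = 0 ∨ ∃ p, c p = 1 := by
  have hm' : (2 : ℝ) ≤ m := by exact_mod_cast hm
  have hshift (j : Fin m) : ∑ i, c (j, (finRotate d).symm i) = ∑ i, c (j, i) :=
    Equiv.sum_comp (finRotate d).symm fun i => c (j, i)
  obtain ⟨j₀, hj₀⟩ : ∃ j, ∑ i, (((m : ℝ) - 2) * c (finRotate m j, i) +
      c (j, (finRotate d).symm i)) < 1 := by
    by_contra! hge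
    have hle := Finset.sum_le_sum fun j (_ : j ∈ Finset.univ) => hge j
    simp only [Finset.sum_add_distrib, hshift, ← Finset.mul_sum] at hle
    rw [Equiv.sum_comp (finRotate m) fun j => ∑ i, c (j, i), ← Fintype.sum_prod_type] at hle
    simp only [Finset.sum_const, Finset.card_univ, Fintype.card_fin, nsmul_eq_mul,
      mul_one] at hle
    nlinarith
  by_cases hone : ∃ p, c p = 1
  · exact Or.inr hone
  push Not at hone
  have hrow₀ : ∀ i, c (j₀, i) = 0 := by
    rcases h j₀ hj₀.le with h0 | ⟨k, hk⟩
    · intro i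
      have hi := congr_fun h0 (finRotate d i)
      simp only [Equiv.symm_apply_apply, Pi.zero_apply] at hi
      have := mul_nonneg (by linarith : (0 : ℝ) ≤ m - 2)
        (hc (finRotate m j₀, finRotate d i))
      linarith [hc (j₀, i)]
    · have : ∑ i, (Pi.single k 1 : Fin d → ℝ) i < 1 := by rw [← hk]; exact hj₀
      simp at this
  have hrow : ∀ j i, c (j, i) = 0 := by
    refine forall_of_finRotate_imp (Q := fun j => ∀ i, c (j, i) = 0) hrow₀ fun j hj => ?_
    have hle : ∑ i, c (j, i) ≤ 1 := by
      refine le_trans ?_ hc1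
      rw [Fintype.sum_prod_type]
      exact Finset.single_le_sum (f := fun j => ∑ i, c (j, i))
        (fun j _ => Finset.sum_nonneg fun i _ => hc _) (Finset.mem_univ j)
    have hblock := h j
    simp only [hj, mul_zero, zero_add, hshift] at hblock
    rcases hblock hle with h0 | ⟨k, hk⟩
    · intro i
      simpa only [Equiv.symm_apply_apply, Pi.zero_apply] using congr_fun h0 (finRotate d i)
    · exact absurd (by simpa using congr_fun hk k) (hone (j, (finRotate d).symm k))
  exact Or.inl (funext fun p => hrow p.1 p.2)

theorem eq_zero_of_sum_le_one_of_eq_one {ι : Type*} [Fintype ι] {c : ι → ℝ}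
    (hc : ∀ i, 0 ≤ c i) (hc1 : ∑ i, c i ≤ 1) {p q : ι} (hp : c p = 1) (hq : q ≠ p) :
    c q = 0 := by
  classical
  have h := (Finset.sum_le_univ_sum_of_nonneg hc (s := {q, p})).trans hc1
  rw [Finset.sum_pair hq, hp] at h
  linarith [hc q]

theorem eq_zero_or_wVec_of_mem_convexHull {d m : ℕ} (hm : 2 ≤ m) {v : Fin d → Fin d → ℤ}
    (hli : LinearIndependent ℝ fun i => fun j => (v i j : ℝ))
    (hempty : ∀ z : Fin d → ℤ,
      (fun j => (z j : ℝ)) ∈ convexHull ℝ ({0} ∪ range (fun i => fun j => (v i j : ℝ))) →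
        z = 0 ∨ ∃ i, z = v i)
    {z : Fin m × Fin d → ℤ}
    (hz : (fun p => (z p : ℝ)) ∈
      convexHull ℝ ({0} ∪ range fun p : Fin m × Fin d => wVec d m v p.2 p.1)) :
    (fun p => (z p : ℝ)) = (0 : Fin m × Fin d → ℝ) ∨
      ∃ i j, (fun p => (z p : ℝ)) = wVec d m v i j := by
  have hm' : (2 : ℝ) ≤ m := by exact_mod_cast hm
  obtain ⟨c, hc, hc1, hsum⟩ := (mem_convexHull_zero_union_range_iff _ _).1 hz
  rw [← hsum]
  have hblock := eq_zero_or_exists_eq_one_of_forall_block hm hc hc1 fun j hj =>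
    coeff_eq_zero_or_single_of_intCast hli hempty
      (fun i => add_nonneg (mul_nonneg (by linarith) (hc _)) (hc _)) hj
      (z := fun k => z (finRotate m j, k))
      (fun k => by rw [← sum_smul_wVec_apply, hsum])
  rcases hblock with rfl | ⟨p, hp⟩
  · left
    simp
  · right
    refine ⟨p.2, p.1, ?_⟩
    rw [Finset.sum_eq_single p, hp, one_smul]
    · intro q _ hq
      rw [eq_zero_of_sum_le_one_of_eq_one hc hc1 hp hq, zero_smul]
    · simp

theorem sebo_generalized (d m : ℕ) (hd : 0 < d) (hm : 2 ≤ m)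
    (v : Fin d → (Fin d → ℤ))
    (haff : AffineIndependent ℝ
      (Fin.cons (0 : Fin d → ℝ) (fun i => fun j => (v i j : ℝ)) :
        Fin (d + 1) → (Fin d → ℝ)))
    (hempty : ∀ z : Fin d → ℤ,
      (fun j => (z j : ℝ)) ∈
          convexHull ℝ ({0} ∪ Set.range (fun i => fun j => (v i j : ℝ))) →
        z = 0 ∨ ∃ i, z = v i) :
    ((m : ℝ) - 3) *
        latticeWidth (convexHull ℝ
          ({0} ∪ Set.range (fun i => fun j => (v i j : ℝ)))) ≤
      latticeWidth (convexHull ℝ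
        ({0} ∪ {x : Fin m × Fin d → ℝ | ∃ i j, x = wVec d m v i j})) ∧
    ∀ z : Fin m × Fin d → ℤ,
      (fun p => (z p : ℝ)) ∈
          convexHull ℝ
            ({0} ∪ {x : Fin m × Fin d → ℝ | ∃ i j, x = wVec d m v i j}) ↔
        ((fun p => (z p : ℝ)) = (0 : Fin m × Fin d → ℝ) ∨
          ∃ i j, (fun p => (z p : ℝ)) = wVec d m v i j) := by
  rw [setOf_eq_wVec]
  refine ⟨sub_three_mul_latticeWidth_le hd hm v, fun z => ⟨fun hz =>
    eq_zero_or_wVec_of_mem_convexHull hm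
      (linearIndependent_of_affineIndependent_cons_zero haff) hempty hz, ?_⟩⟩
  rintro (h | ⟨i, j, h⟩) <;> rw [h] <;> apply subset_convexHull
  · exact Or.inl rfl
  · exact Or.inr ⟨(j, i), rfl⟩
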